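/- arXiv:1801.05015 — 2 statements merged into one kernel-verified Lean document; each statement's English description precedes it below -/
import Mathlib

section
/- Suppose a, b, c are states such that the formal processes (a, b) and (a, c) are possible (a ⇌ b and a ⇌ c). Then the formal process (b, c) is possible (b ⇌ c). -/
structure EidoSys where
  State : Type
  [decEq : DecidableEq State]
  Eido : Set (Finset State)
  pair : State → State → State
  Sim : Finset State → Finset State → Prop
  Arrow : Finset State → Finset State → Prop
  pair_inj : ∀ a b a' b', pair a b = pair a' b' → a = a' ∧ b = b'
  eido_nonempty : ∀ A ∈ Eido, A.Nonempty
  singleton_mem : ∀ a : State, ({a} : Finset State) ∈ Eido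
  comb_mem : ∀ A B : Finset State, Finset.image₂ pair A B ∈ Eido ↔ A ∈ Eido ∧ B ∈ Eido
  subset_mem : ∀ A B : Finset State, A ∈ Eido → B ⊆ A → B.Nonempty → B ∈ Eido
  sim_refl : ∀ A : Finset State, Sim A A
  sim_symm : ∀ A B : Finset State, Sim A B → Sim B A
  sim_trans : ∀ A B C : Finset State, Sim A B → Sim B C → Sim A C
  sim_comm : ∀ A B : Finset State, Sim (Finset.image₂ pair A B) (Finset.image₂ pair B A)
  sim_assoc : ∀ A B C : Finset State,
    Sim (Finset.image₂ pair (Finset.image₂ pair A B) C) (Finset.image₂ pair A (Finset.image₂ pair B C))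
  sim_congr : ∀ A B C : Finset State, Sim A B → Sim (Finset.image₂ pair A C) (Finset.image₂ pair B C)
  arrow_of_sim : ∀ A B : Finset State, A ∈ Eido → B ∈ Eido → Sim A B → Arrow A B
  arrow_trans : ∀ A B C : Finset State, Arrow A B → Arrow B C → Arrow A C
  arrow_comb : ∀ A B C : Finset State, Arrow A B → Arrow (Finset.image₂ pair A C) (Finset.image₂ pair B C)
  arrow_cancel : ∀ (A B : Finset State) (s : State),
    Arrow (Finset.image₂ pair A {s}) (Finset.image₂ pair B {s}) → Arrow A B
  arrow_nsubset : ∀ A B : Finset State, A ∈ Eido → B ∈ Eido → B ⊂ A → ¬ Arrow A B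
  arrow_subset_single : ∀ (A A' : Finset State) (b : State),
    A ∈ Eido → A' ⊆ A → A'.Nonempty → Arrow A {b} → Arrow A' {b}
  arrow_union : ∀ A₁ A₂ B₁ B₂ : Finset State,
    A₁ ∈ Eido → A₂ ∈ Eido → B₁ ∈ Eido → B₂ ∈ Eido →
    Disjoint A₁ A₂ → Disjoint B₁ B₂ →
    (∀ a ∈ A₁ ∪ A₂, ∀ b ∈ A₁ ∪ A₂, Arrow {a} {b} ∨ Arrow {b} {a}) →
    (∀ a ∈ B₁ ∪ B₂, ∀ b ∈ B₁ ∪ B₂, Arrow {a} {b} ∨ Arrow {b} {a}) →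
    Arrow A₁ B₁ → Arrow A₂ B₂ → Arrow (A₁ ∪ A₂) (B₁ ∪ B₂)

attribute [instance] EidoSys.decEq

namespace EidoSys

variable (S : EidoSys)

/-- Combination of eidostates: the Cartesian product, realized via the pairing map. -/
def comb (A B : Finset S.State) : Finset S.State := Finset.image₂ S.pair A B

/-- The process (A,B) is possible: A ⇌ B. -/
def Pos (A B : Finset S.State) : Prop := S.Arrow A B ∨ S.Arrow B A

/-- A ↔ B. -/
def Rev (A B : Finset S.State) : Prop := S.Arrow A B ∧ S.Arrow B A

/-- Uniform eidostate. -/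
def Uniform (A : Finset S.State) : Prop := A ∈ S.Eido ∧ ∀ a ∈ A, ∀ b ∈ A, S.Pos {a} {b}

/-- Record state: a ↔ a + r for some state a. -/
def IsRecord (r : S.State) : Prop := ∃ a : S.State, S.Rev {a} (S.comb {a} {r})

/-- Information state: an eidostate all of whose elements are record states. -/
def IsInfo (I : Finset S.State) : Prop := I ∈ S.Eido ∧ ∀ r ∈ I, S.IsRecord r

/-- Bit state: an information state with exactly two elements. -/
def IsBit (I : Finset S.State) : Prop := S.IsInfo I ∧ I.card = 2

/-- Information axiom: there exist a bit state and a possible bit process. -/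
def InfoAxiom : Prop := ∃ (r : S.State) (I : Finset S.State), S.IsRecord r ∧ S.IsBit I ∧ S.Pos {r} I

/-- Demon axiom. -/
def DemonAxiom : Prop := ∀ a b : S.State, ∀ J : Finset S.State, S.IsInfo J →
    S.Arrow {a} (S.comb {b} J) →
    (∃ I : Finset S.State, S.IsInfo I ∧ S.Arrow {b} (S.comb {a} I)) ∧
    (∀ I : Finset S.State, S.IsInfo I → S.Arrow {a} (S.comb {b} I) ∨ S.Arrow (S.comb {b} I) {a})

/-- `copies A n` is the combination of `n+1` copies of `A` (so `copies A 0 = A`). -/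
def copies (A : Finset S.State) : ℕ → Finset S.State
  | 0 => A
  | n + 1 => S.comb A (copies A n)

/-- Stability axiom: if nA → nB + J for arbitrarily large n, then A → B. -/
def StabilityAxiom : Prop := ∀ A B J : Finset S.State, A ∈ S.Eido → B ∈ S.Eido → S.IsInfo J →
    (∀ N : ℕ, ∃ n ≥ N, S.Arrow (S.copies A n) (S.comb (S.copies B n) J)) → S.Arrow A B

/-- State-equivalence axiom. -/
def StateEquivAxiom : Prop := ∀ E : Finset S.State, S.Uniform E →
    ∃ e x y : S.State, S.Arrow {x} {y} ∧ S.Rev (S.comb E {x}) (S.comb {e} {y})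

/-- `addCopies A B k` is A + k·B (k copies of B appended to A). -/
def addCopies (A B : Finset S.State) : ℕ → Finset S.State
  | 0 => A
  | k + 1 => S.comb (addCopies A B k) B

/-- A designated set of mechanical states. -/
def MechSet (M : Set S.State) : Prop :=
  (∀ l ∈ M, ∀ m ∈ M, S.pair l m ∈ M) ∧
  (∀ l ∈ M, ∀ m ∈ M, S.Arrow {l} {m} → S.Arrow {m} {l})

/-- Component of content on uniform eidostates. -/
def IsCoCU (Q : Finset S.State → ℝ) : Prop :=
  (∀ E F : Finset S.State, S.Uniform E → S.Uniform F → Q (S.comb E F) = Q E + Q F) ∧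
  (∀ E F : Finset S.State, S.Uniform E → S.Uniform F → S.Pos E F → Q E = Q F)

/-- Entropy function on the uniform eidostates (relative to mechanical states M). -/
def IsEntropyU (M : Set S.State) (Ent : Finset S.State → ℝ) : Prop :=
  (∀ E F : Finset S.State, S.Uniform E → S.Uniform F → Ent (S.comb E F) = Ent E + Ent F) ∧
  (∀ E F : Finset S.State, S.Uniform E → S.Uniform F → S.Pos E F → (S.Arrow E F ↔ Ent E ≤ Ent F)) ∧
  (∀ m ∈ M, Ent {m} = 0) ∧
  (∀ I : Finset S.State, S.IsInfo I → Ent I = Real.logb 2 (I.card))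

end EidoSys

namespace EidoSys

variable {S : EidoSys}

theorem arrow_pair_comm (x y : S.State) : S.Arrow {S.pair x y} {S.pair y x} :=
  S.arrow_of_sim _ _ (S.singleton_mem _) (S.singleton_mem _) (by simpa using S.sim_comm {x} {y})

theorem arrow_pair_assoc (x y z : S.State) :
    S.Arrow {S.pair (S.pair x y) z} {S.pair x (S.pair y z)} :=
  S.arrow_of_sim _ _ (S.singleton_mem _) (S.singleton_mem _)
    (by simpa using S.sim_assoc {x} {y} {z})

theorem arrow_pair_assoc_symm (x y z : S.State) :
    S.Arrow {S.pair x (S.pair y z)} {S.pair (S.pair x y) z} :=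
  S.arrow_of_sim _ _ (S.singleton_mem _) (S.singleton_mem _)
    (S.sim_symm _ _ (by simpa using S.sim_assoc {x} {y} {z}))

theorem arrow_pair_right {x y : S.State} (h : S.Arrow {x} {y}) (z : S.State) :
    S.Arrow {S.pair x z} {S.pair y z} := by
  simpa using S.arrow_comb _ _ {z} h

theorem arrow_of_pair_right {x y z : S.State} (h : S.Arrow {S.pair x z} {S.pair y z}) :
    S.Arrow {x} {y} :=
  S.arrow_cancel _ _ z (by simpa using h)

/-- A record state can be adjoined to, or removed from, any state. -/
theorem IsRecord.rev_comb {r : S.State} (hr : S.IsRecord r) (x : S.State) :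
    S.Rev {x} (S.comb {x} {r}) := by
  obtain ⟨a, h₁, h₂⟩ := hr
  simp only [Rev, comb, Finset.image₂_singleton] at h₁ h₂ ⊢
  constructor
  · refine arrow_of_pair_right (z := a) ?_
    refine S.arrow_trans _ _ _ (arrow_pair_comm x a) ?_
    refine S.arrow_trans _ _ _ (arrow_pair_right h₁ x) ?_
    refine S.arrow_trans _ _ _ (arrow_pair_assoc a r x) ?_
    refine S.arrow_trans _ _ _ (arrow_pair_comm a _) ?_
    exact arrow_pair_right (arrow_pair_comm r x) a
  · refine arrow_of_pair_right (z := a) ?_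
    refine S.arrow_trans _ _ _ (arrow_pair_right (arrow_pair_comm x r) a) ?_
    refine S.arrow_trans _ _ _ (arrow_pair_comm _ a) ?_
    refine S.arrow_trans _ _ _ (arrow_pair_assoc_symm a r x) ?_
    refine S.arrow_trans _ _ _ (arrow_pair_right h₂ x) ?_
    exact arrow_pair_comm a x

theorem IsRecord.isInfo_singleton {r : S.State} (hr : S.IsRecord r) : S.IsInfo {r} :=
  ⟨S.singleton_mem r, by simpa using hr⟩

theorem InfoAxiom.exists_isRecord (hinfo : S.InfoAxiom) : ∃ r, S.IsRecord r := by
  obtain ⟨r, _, hr, _⟩ := hinfo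
  exact ⟨r, hr⟩

theorem DemonAxiom.pos_of_arrow_comb (hdemon : S.DemonAxiom) (hinfo : S.InfoAxiom)
    {a b : S.State} {J : Finset S.State} (hJ : S.IsInfo J) (h : S.Arrow {a} (S.comb {b} J)) :
    S.Pos {a} {b} := by
  obtain ⟨r, hr⟩ := hinfo.exists_isRecord
  have hb := hr.rev_comb b
  exact ((hdemon a b J hJ h).2 {r} hr.isInfo_singleton).imp
    (fun h' => S.arrow_trans _ _ _ h' hb.2) (fun h' => S.arrow_trans _ _ _ hb.1 h')

theorem DemonAxiom.exists_arrow_comb_of_arrow (hdemon : S.DemonAxiom) (hinfo : S.InfoAxiom)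
    {a b : S.State} (h : S.Arrow {a} {b}) :
    ∃ I : Finset S.State, S.IsInfo I ∧ S.Arrow {b} (S.comb {a} I) := by
  obtain ⟨r, hr⟩ := hinfo.exists_isRecord
  exact (hdemon a b {r} hr.isInfo_singleton (S.arrow_trans _ _ _ h (hr.rev_comb b).1)).1

end EidoSys

/-- If (a,b) and (a,c) are possible singleton processes, then (b,c) is possible. -/
theorem stmt5 (S : EidoSys) (hinfo : S.InfoAxiom) (hdemon : S.DemonAxiom) :
    ∀ a b c : S.State, S.Pos {a} {b} → S.Pos {a} {c} → S.Pos {b} {c} := by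
  rintro a b c (hab | hba) (hac | hca)
  · obtain ⟨I, hI, h⟩ := hdemon.exists_arrow_comb_of_arrow hinfo hab
    exact hdemon.pos_of_arrow_comb hinfo hI (S.arrow_trans _ _ _ h (S.arrow_comb _ _ I hac))
  · exact Or.inr (S.arrow_trans _ _ _ hca hab)
  · exact Or.inl (S.arrow_trans _ _ _ hba hac)
  · obtain ⟨I, hI, h⟩ := hdemon.exists_arrow_comb_of_arrow hinfo hba
    exact (hdemon.pos_of_arrow_comb hinfo hI (S.arrow_trans _ _ _ hca h)).symm
end

section
/- Let P̂_S be the set of ≐-classes of possible singleton processes and let Θ_b be the class of a bit process (r, I_b). For each α ∈ P̂_S define L_α = { p/q : q > 0, qα − pΘ_b is natural } and U_α = { p/q : q > 0, pΘ_b − qα is natural }. Then (L_α, U_α) is a Dedekind cut of the rationals, and the function 𝕀(α) := sup L_α = inf U_α is an irreversibility function on P̂_S. -/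
namespace EidoSys

variable (S : EidoSys)

/-- A formal process: an ordered pair of eidostates. -/
abbrev Proc := Finset S.State × Finset S.State

/-- Sum of formal processes. -/
def psum (p q : S.Proc) : S.Proc := (S.comb p.1 q.1, S.comb p.2 q.2)

/-- Negation of a formal process. -/
def pneg (p : S.Proc) : S.Proc := (p.2, p.1)

/-- The equivalence ≐ of formal processes: (A,B) ≐ (C,D) iff there are states x, y with
A + x ∼ C + y and B + x ∼ D + y. -/
def Peq (p q : S.Proc) : Prop :=
  ∃ x y : S.State, S.Sim (S.comb p.1 {x}) (S.comb q.1 {y}) ∧ S.Sim (S.comb p.2 {x}) (S.comb q.2 {y})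

/-- An irreversibility function on a ≐-saturated collection P of possible processes
(representing a collection of ≐-classes): a ≐-invariant, additive real function whose sign
determines the type of each process. -/
def IsIrrevFn (P : Set S.Proc) (I : S.Proc → ℝ) : Prop :=
  (∀ p ∈ P, ∀ q ∈ P, S.Peq p q → I p = I q) ∧
  (∀ p ∈ P, ∀ q ∈ P, I (S.psum p q) = I p + I q) ∧
  (∀ p ∈ P, S.Arrow p.1 p.2 → ¬ S.Arrow p.2 p.1 → 0 < I p) ∧
  (∀ p ∈ P, S.Arrow p.1 p.2 → S.Arrow p.2 p.1 → I p = 0) ∧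
  (∀ p ∈ P, S.Arrow p.2 p.1 → ¬ S.Arrow p.1 p.2 → I p < 0)

end EidoSys

namespace EidoSys

variable (S : EidoSys)

/-- The formal process qα − pΘ_b, where α = (A, B) (with q ≥ 1 copies, `copies X (q-1)`),
Θ_b = ({r}, Ib) is a bit process, and p ∈ ℤ (negative p meaning |p| copies of +Θ_b). -/
def qpProc (A B : Finset S.State) (r : S.State) (Ib : Finset S.State) (q : ℕ) (p : ℤ) :
    S.Proc :=
  if 0 ≤ p then
    (S.addCopies (S.copies A (q - 1)) Ib p.toNat, S.addCopies (S.copies B (q - 1)) {r} p.toNat)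
  else
    (S.addCopies (S.copies A (q - 1)) {r} (-p).toNat, S.addCopies (S.copies B (q - 1)) Ib (-p).toNat)

/-- L_α = { p/q : q > 0, qα − pΘ_b is natural }. -/
def LSet (A B : Finset S.State) (r : S.State) (Ib : Finset S.State) : Set ℚ :=
  { x | ∃ (p : ℤ) (q : ℕ), 0 < q ∧ x = (p : ℚ) / (q : ℚ) ∧
      S.Arrow (S.qpProc A B r Ib q p).1 (S.qpProc A B r Ib q p).2 }

/-- U_α = { p/q : q > 0, pΘ_b − qα is natural }. -/
def USet (A B : Finset S.State) (r : S.State) (Ib : Finset S.State) : Set ℚ :=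
  { x | ∃ (p : ℤ) (q : ℕ), 0 < q ∧ x = (p : ℚ) / (q : ℚ) ∧
      S.Arrow (S.qpProc A B r Ib q p).2 (S.qpProc A B r Ib q p).1 }

/-- The irreversibility value 𝕀(α) := sup L_α, via the Dedekind-cut construction. -/
noncomputable def IrrFn (r : S.State) (Ib : Finset S.State) (pr : S.Proc) : ℝ :=
  sSup ((fun x : ℚ => (x : ℝ)) '' S.LSet pr.1 pr.2 r Ib)

end EidoSys

section BitMonoid

variable {M : Type*} [AddCommMonoid M] [PartialOrder M]

/-- The rationals `p / q` for which `q • (s, t) - p • (0, β)` is natural. -/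
def lowerCut (β s t : M) : Set ℚ :=
  { x | ∃ (p : ℤ) (q : ℕ), 0 < q ∧ x = (p : ℚ) / (q : ℚ) ∧
      q • s + p.toNat • β ≤ q • t + (-p).toNat • β }

/-- The rationals `p / q` for which `p • (0, β) - q • (s, t)` is natural. -/
def upperCut (β s t : M) : Set ℚ :=
  { x | ∃ (p : ℤ) (q : ℕ), 0 < q ∧ x = (p : ℚ) / (q : ℚ) ∧
      q • t + (-p).toNat • β ≤ q • s + p.toNat • β }

/-- The supremum of the lower cut. -/
noncomputable def cutValue (β s t : M) : ℝ :=
  sSup ((fun x : ℚ => (x : ℝ)) '' lowerCut β s t)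

/-- `s` can be turned into `t` at the cost of producing some number of bits. -/
def Near (β s t : M) : Prop := ∃ k : ℕ, s ≤ t + k • β

/-- An ordered monoid of eidostates up to `↔`, in which `x ≤ y` stands for `x → y`, with its
singleton states and a bit state `β`. -/
structure IsBitMonoid (T : AddSubmonoid M) (β : M) : Prop where
  cancel : ∀ x y : M, ∀ s ∈ T, x + s ≤ y + s → x ≤ y
  bits : ∀ i j : ℕ, i • β ≤ j • β → i ≤ j
  near_symm : ∀ s ∈ T, ∀ t ∈ T, Near β s t → Near β t s
  total : ∀ s ∈ T, ∀ t ∈ T, Near β s t → ∀ k : ℕ, s ≤ t + k • β ∨ t + k • β ≤ s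
  stable : ∀ s ∈ T, ∀ t ∈ T, (∀ n : ℕ, (n + 1) • s ≤ (n + 1) • t + β) → s ≤ t

theorem Rat.cast_sSup_eq_sInf_of_cut {L U : Set ℚ} (hL : L.Nonempty) (hU : U.Nonempty)
    (htot : ∀ x, x ∈ L ∪ U) (hle : ∀ x ∈ L, ∀ y ∈ U, x ≤ y) :
    sSup ((fun x : ℚ => (x : ℝ)) '' L) = sInf ((fun x : ℚ => (x : ℝ)) '' U) := by
  obtain ⟨l, hl⟩ := hL
  obtain ⟨u, hu⟩ := hU
  have hbdL : BddAbove ((fun x : ℚ => (x : ℝ)) '' L) :=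
    ⟨u, by rintro _ ⟨x, hx, rfl⟩; exact Rat.cast_le.mpr (hle x hx u hu)⟩
  have hbdU : BddBelow ((fun x : ℚ => (x : ℝ)) '' U) :=
    ⟨l, by rintro _ ⟨x, hx, rfl⟩; exact Rat.cast_le.mpr (hle l hl x hx)⟩
  apply le_antisymm
  · apply csSup_le (Set.Nonempty.image _ ⟨l, hl⟩)
    rintro _ ⟨x, hx, rfl⟩
    apply le_csInf (Set.Nonempty.image _ ⟨u, hu⟩)
    rintro _ ⟨y, hy, rfl⟩
    exact Rat.cast_le.mpr (hle x hx y hy)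
  · by_contra! h
    obtain ⟨z, hz₁, hz₂⟩ := exists_rat_btwn h
    rcases htot z with hz | hz
    · exact absurd (le_csSup hbdL ⟨z, hz, rfl⟩) (not_le.mpr hz₁)
    · exact absurd (csInf_le hbdU ⟨z, hz, rfl⟩) (not_le.mpr hz₂)

variable {β s t s' t' : M}

theorem Near.of_le (h : s ≤ t) : Near β s t := ⟨0, by simpa using h⟩

theorem lowerCut_nonempty (h : Near β s t) : (lowerCut β s t).Nonempty := by
  obtain ⟨k, hk⟩ := h
  exact ⟨_, -k, 1, one_pos, rfl, by simpa using hk⟩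

theorem upperCut_nonempty (h : Near β t s) : (upperCut β s t).Nonempty := by
  obtain ⟨k, hk⟩ := h
  exact ⟨_, k, 1, one_pos, rfl, by simpa using hk⟩

variable [IsOrderedAddMonoid M]

theorem Near.add (h : Near β s t) (h' : Near β s' t') : Near β (s + s') (t + t') := by
  obtain ⟨k, hk⟩ := h
  obtain ⟨k', hk'⟩ := h'
  refine ⟨k + k', (add_le_add hk hk').trans_eq ?_⟩
  rw [add_nsmul]; abel

theorem Near.nsmul (h : Near β s t) (q : ℕ) : Near β (q • s) (q • t) := by
  obtain ⟨k, hk⟩ := h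
  refine ⟨q * k, (nsmul_le_nsmul_right hk q).trans_eq ?_⟩
  rw [nsmul_add, mul_nsmul']

namespace IsBitMonoid

variable {T : AddSubmonoid M}

theorem cut_total (H : IsBitMonoid T β) (hs : s ∈ T) (ht : t ∈ T) (h : Near β s t)
    (q : ℕ) (p : ℤ) :
    q • s + p.toNat • β ≤ q • t + (-p).toNat • β ∨
      q • t + (-p).toNat • β ≤ q • s + p.toNat • β := by
  have hqs := T.nsmul_mem hs q
  have hqt := T.nsmul_mem ht q
  rcases le_total 0 p with hp | hp
  · have h0 : (-p).toNat = 0 := by omega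
    simpa [h0] using (H.total _ hqt _ hqs ((H.near_symm s hs t ht h).nsmul q) p.toNat).symm
  · have h0 : p.toNat = 0 := by omega
    simpa [h0] using H.total _ hqs _ hqt (h.nsmul q) (-p).toNat

theorem mem_lowerCut_union_upperCut (H : IsBitMonoid T β) (hs : s ∈ T) (ht : t ∈ T)
    (h : Near β s t) (x : ℚ) : x ∈ lowerCut β s t ∪ upperCut β s t := by
  rcases H.cut_total hs ht h x.den x.num with h | h
  · exact Or.inl ⟨x.num, x.den, x.den_pos, (Rat.num_div_den x).symm, h⟩
  · exact Or.inr ⟨x.num, x.den, x.den_pos, (Rat.num_div_den x).symm, h⟩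

/-- If `q • (s, t)` absorbs `i - j` bits and `q' • (t, s)` absorbs `i' - j'` bits, then the
combined bit process is natural, so its number of bits cannot decrease. -/
theorem bits_le (H : IsBitMonoid T β) (hs : s ∈ T) (ht : t ∈ T) {q q' i j i' j' : ℕ}
    (h : q • s + i • β ≤ q • t + j • β) (h' : q' • t + i' • β ≤ q' • s + j' • β) :
    q' * i + q * i' ≤ q' * j + q * j' := by
  apply H.bits
  apply H.cancel _ _ _ (T.add_mem (T.nsmul_mem hs (q' * q)) (T.nsmul_mem ht (q' * q)))
  have h₁ := add_le_add (nsmul_le_nsmul_right h q') (nsmul_le_nsmul_right h' q)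
  simp only [nsmul_add, ← mul_nsmul'] at h₁
  rw [mul_comm q q'] at h₁
  simp only [add_nsmul]
  calc _ = _ := by abel
    _ ≤ _ := h₁
    _ = _ := by abel

theorem div_le_div_of_cuts (H : IsBitMonoid T β) (hs : s ∈ T) (ht : t ∈ T) {q q' i j i' j' : ℕ}
    (hq : 0 < q) (hq' : 0 < q')
    (h : q • s + i • β ≤ q • t + j • β) (h' : q' • t + j' • β ≤ q' • s + i' • β) :
    ((i : ℝ) - j) / q ≤ ((i' : ℝ) - j') / q' := by
  have h₁ := H.bits_le hs ht h h'
  rw [div_le_div_iff₀ (by positivity) (by positivity)]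
  have h₂ : (q' : ℝ) * i + q * j' ≤ q' * j + q * i' := by exact_mod_cast h₁
  linarith

theorem cast_cut_eq (p : ℤ) (q : ℕ) :
    (((p : ℚ) / (q : ℚ) : ℚ) : ℝ) = ((p.toNat : ℝ) - ((-p).toNat : ℝ)) / q := by
  have : ((p.toNat : ℤ) - ((-p).toNat : ℤ)) = p := by omega
  have h : ((p.toNat : ℝ) - ((-p).toNat : ℝ)) = p := by exact_mod_cast this
  rw [h]; push_cast; rfl

theorem lowerCut_le_upperCut (H : IsBitMonoid T β) (hs : s ∈ T) (ht : t ∈ T) :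
    ∀ x ∈ lowerCut β s t, ∀ y ∈ upperCut β s t, x ≤ y := by
  rintro _ ⟨p, q, hq, rfl, h⟩ _ ⟨p', q', hq', rfl, h'⟩
  rw [← Rat.cast_le (K := ℝ), cast_cut_eq, cast_cut_eq]
  exact H.div_le_div_of_cuts hs ht hq hq' h h'

theorem cutValue_eq_sInf (H : IsBitMonoid T β) (hs : s ∈ T) (ht : t ∈ T) (h : Near β s t) :
    cutValue β s t = sInf ((fun x : ℚ => (x : ℝ)) '' upperCut β s t) :=
  Rat.cast_sSup_eq_sInf_of_cut (lowerCut_nonempty h)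
    (upperCut_nonempty (H.near_symm s hs t ht h)) (H.mem_lowerCut_union_upperCut hs ht h)
    (H.lowerCut_le_upperCut hs ht)

theorem le_cutValue (H : IsBitMonoid T β) (hs : s ∈ T) (ht : t ∈ T) (h : Near β s t)
    {q i j : ℕ} (hq : 0 < q) (hle : q • s + i • β ≤ q • t + j • β) :
    ((i : ℝ) - j) / q ≤ cutValue β s t := by
  rw [H.cutValue_eq_sInf hs ht h]
  apply le_csInf ((upperCut_nonempty (H.near_symm s hs t ht h)).image _)
  rintro _ ⟨_, ⟨p, q', hq', rfl, h'⟩, rfl⟩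
  simp only [cast_cut_eq]
  exact H.div_le_div_of_cuts hs ht hq hq' hle h'

theorem cutValue_le (H : IsBitMonoid T β) (hs : s ∈ T) (ht : t ∈ T) (h : Near β s t)
    {q i j : ℕ} (hq : 0 < q) (hle : q • t + j • β ≤ q • s + i • β) :
    cutValue β s t ≤ ((i : ℝ) - j) / q := by
  apply csSup_le ((lowerCut_nonempty h).image _)
  rintro _ ⟨_, ⟨p, q', hq', rfl, h'⟩, rfl⟩
  simp only [cast_cut_eq]
  exact H.div_le_div_of_cuts hs ht hq' hq h' hle

theorem cutValue_swap_le (H : IsBitMonoid T β) (hs : s ∈ T) (ht : t ∈ T) (h : Near β s t) :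
    cutValue β t s ≤ -cutValue β s t := by
  have h' := H.near_symm s hs t ht h
  apply csSup_le ((lowerCut_nonempty h').image _)
  rintro _ ⟨_, ⟨p, q, hq, rfl, hle⟩, rfl⟩
  have := H.cutValue_le hs ht h hq hle
  simp only [cast_cut_eq]
  have h₂ : ((p.toNat : ℝ) - ((-p).toNat : ℝ)) / q = -((((-p).toNat : ℝ) - (p.toNat : ℝ)) / q) := by
    ring
  linarith

theorem le_cutValue_add (H : IsBitMonoid T β) (hs : s ∈ T) (ht : t ∈ T) (h : Near β s t)
    (hs' : s' ∈ T) (ht' : t' ∈ T) (h' : Near β s' t') :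
    cutValue β s t + cutValue β s' t' ≤ cutValue β (s + s') (t + t') := by
  rw [← le_sub_iff_add_le]
  apply csSup_le ((lowerCut_nonempty h).image _)
  rintro _ ⟨_, ⟨p, q, hq, rfl, hle⟩, rfl⟩
  rw [le_sub_comm]
  apply csSup_le ((lowerCut_nonempty h').image _)
  rintro _ ⟨_, ⟨p', q', hq', rfl, hle'⟩, rfl⟩
  simp only [cast_cut_eq]
  generalize p.toNat = i at *
  generalize (-p).toNat = j at *
  generalize p'.toNat = i' at *
  generalize (-p').toNat = j' at *
  have h₁ := add_le_add (nsmul_le_nsmul_right hle q') (nsmul_le_nsmul_right hle' q)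
  have h₂ : (q' * q) • (s + s') + (q' * i + q * i') • β ≤
      (q' * q) • (t + t') + (q' * j + q * j') • β := by
    simp only [nsmul_add, ← mul_nsmul'] at h₁
    rw [mul_comm q q'] at h₁
    simp only [add_nsmul, nsmul_add]
    calc _ = _ := by abel
      _ ≤ _ := h₁
      _ = _ := by abel
  have h₃ := H.le_cutValue (T.add_mem hs hs') (T.add_mem ht ht') (h.add h')
    (Nat.mul_pos hq' hq) h₂
  have h₄ : (((q' * i + q * i' : ℕ) : ℝ) - ((q' * j + q * j' : ℕ) : ℝ)) / ((q' * q : ℕ) : ℝ) =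
      ((i : ℝ) - j) / q + ((i' : ℝ) - j') / q' := by
    have : (q : ℝ) ≠ 0 := by positivity
    have : (q' : ℝ) ≠ 0 := by positivity
    push_cast
    field_simp
    ring
  linarith

theorem cutValue_eq_zero (H : IsBitMonoid T β) (hs : s ∈ T) (ht : t ∈ T)
    (h : s ≤ t) (h' : t ≤ s) : cutValue β s t = 0 := by
  have h₁ := H.le_cutValue hs ht (.of_le h) (q := 1) (i := 0) (j := 0) one_pos (by simpa using h)
  have h₂ := H.cutValue_le hs ht (.of_le h) (q := 1) (i := 0) (j := 0) one_pos (by simpa using h')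
  simp only [Nat.cast_zero, sub_zero, zero_div] at h₁ h₂
  exact le_antisymm h₂ h₁

theorem cutValue_swap (H : IsBitMonoid T β) (hs : s ∈ T) (ht : t ∈ T) (h : Near β s t) :
    cutValue β t s = -cutValue β s t := by
  have h' := H.near_symm s hs t ht h
  apply le_antisymm (H.cutValue_swap_le hs ht h)
  rw [H.cutValue_eq_sInf ht hs h']
  apply le_csInf ((upperCut_nonempty h).image _)
  rintro _ ⟨_, ⟨p, q, hq, rfl, hle⟩, rfl⟩
  have := H.le_cutValue hs ht h hq hle
  simp only [cast_cut_eq]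
  have h₂ : ((p.toNat : ℝ) - ((-p).toNat : ℝ)) / q = -((((-p).toNat : ℝ) - (p.toNat : ℝ)) / q) := by
    ring
  linarith

theorem cutValue_add (H : IsBitMonoid T β) (hs : s ∈ T) (ht : t ∈ T) (h : Near β s t)
    (hs' : s' ∈ T) (ht' : t' ∈ T) (h' : Near β s' t') :
    cutValue β (s + s') (t + t') = cutValue β s t + cutValue β s' t' := by
  have h₁ := H.le_cutValue_add hs ht h hs' ht' h'
  have h₂ := H.le_cutValue_add ht hs (H.near_symm s hs t ht h) ht' hs' (H.near_symm s' hs' t' ht' h')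
  rw [H.cutValue_swap hs ht h, H.cutValue_swap hs' ht' h',
    H.cutValue_swap (T.add_mem hs hs') (T.add_mem ht ht') (h.add h')] at h₂
  linarith

theorem cutValue_pos (H : IsBitMonoid T β) (hs : s ∈ T) (ht : t ∈ T)
    (h : s ≤ t) (h' : ¬ t ≤ s) : 0 < cutValue β s t := by
  have hn : Near β s t := .of_le h
  obtain ⟨n, hle⟩ : ∃ n : ℕ, ¬ (n + 1) • t ≤ (n + 1) • s + β := by
    by_contra! hall
    exact h' (H.stable t ht s hs hall)
  have hle' : (n + 1) • s + 1 • β ≤ (n + 1) • t + 0 • β := by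
    have := (H.cut_total hs ht hn (n + 1) 1).resolve_right
    simpa using this (by simpa using hle)
  refine lt_of_lt_of_le ?_ (H.le_cutValue hs ht hn n.succ_pos hle')
  have : (0 : ℝ) < (n.succ : ℝ) := by positivity
  simpa using this

/-- Processes which become equal after adding states have equal values. -/
theorem cutValue_congr (H : IsBitMonoid T β) (hs : s ∈ T) (ht : t ∈ T) (h : Near β s t)
    (hs' : s' ∈ T) (ht' : t' ∈ T) (h' : Near β s' t') {x y : M} (hx : x ∈ T) (hy : y ∈ T)
    (h₁ : s + x = s' + y) (h₂ : t + x = t' + y) : cutValue β s t = cutValue β s' t' := by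
  have h₃ := H.cutValue_add hs ht h hx hx (.of_le le_rfl)
  have h₄ := H.cutValue_add hs' ht' h' hy hy (.of_le le_rfl)
  rw [H.cutValue_eq_zero hx hx le_rfl le_rfl] at h₃
  rw [H.cutValue_eq_zero hy hy le_rfl le_rfl] at h₄
  rw [h₁, h₂] at h₃
  linarith

end IsBitMonoid

end BitMonoid

namespace EidoSys

variable {S : EidoSys} {A B C D I J : Finset S.State} {a b r s : S.State}

theorem comb_singleton (a b : S.State) : S.comb {a} {b} = {S.pair a b} :=
  Finset.image₂_singleton

theorem comb_mem_eido (hA : A ∈ S.Eido) (hB : B ∈ S.Eido) : S.comb A B ∈ S.Eido :=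
  (S.comb_mem A B).mpr ⟨hA, hB⟩

theorem arrow_refl (hA : A ∈ S.Eido) : S.Arrow A A :=
  S.arrow_of_sim A A hA hA (S.sim_refl A)

theorem comb_comm_arrow (hA : A ∈ S.Eido) (hB : B ∈ S.Eido) :
    S.Arrow (S.comb A B) (S.comb B A) :=
  S.arrow_of_sim _ _ (comb_mem_eido hA hB) (comb_mem_eido hB hA) (S.sim_comm A B)

theorem comb_arrow_comb (hB : B ∈ S.Eido) (hC : C ∈ S.Eido) (hD : D ∈ S.Eido)
    (h : S.Arrow A B) (h' : S.Arrow C D) : S.Arrow (S.comb A C) (S.comb B D) := by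
  have h₁ : S.Arrow (S.comb C B) (S.comb D B) := S.arrow_comb _ _ _ h'
  have h₂ : S.Arrow (S.comb B C) (S.comb B D) :=
    S.arrow_trans _ _ _ (comb_comm_arrow hB hC) (S.arrow_trans _ _ _ h₁ (comb_comm_arrow hD hB))
  exact S.arrow_trans _ _ _ (S.arrow_comb _ _ _ h) h₂

/-- The type of eidostates, preordered by the arrow relation. -/
def Eidostate (S : EidoSys) : Type := { A : Finset S.State // A ∈ S.Eido }

instance : Preorder S.Eidostate where
  le A B := S.Arrow A.1 B.1
  le_refl A := arrow_refl A.2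
  le_trans _ _ _ := S.arrow_trans _ _ _

/-- Eidostates up to `↔`. The record state `r` provides the neutral element. -/
def Content (S : EidoSys) (r : S.State) (_hr : S.IsRecord r) : Type :=
  Antisymmetrization S.Eidostate (· ≤ ·)

namespace Content

variable {hr : S.IsRecord r}

instance : PartialOrder (S.Content r hr) :=
  inferInstanceAs (PartialOrder (Antisymmetrization S.Eidostate (· ≤ ·)))

/-- The class of an eidostate. -/
def mk (hr : S.IsRecord r) (A : Finset S.State) (hA : A ∈ S.Eido) : S.Content r hr :=
  toAntisymmetrization (α := S.Eidostate) (· ≤ ·) ⟨A, hA⟩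

theorem mk_le_mk {hA : A ∈ S.Eido} {hB : B ∈ S.Eido} : mk hr A hA ≤ mk hr B hB ↔ S.Arrow A B :=
  Iff.rfl

theorem mk_eq_mk {hA : A ∈ S.Eido} {hB : B ∈ S.Eido} : mk hr A hA = mk hr B hB ↔ S.Rev A B :=
  le_antisymm_iff

theorem ind {P : S.Content r hr → Prop}
    (h : ∀ (A : Finset S.State) (hA : A ∈ S.Eido), P (mk hr A hA)) (x : S.Content r hr) : P x :=
  Quotient.ind (fun A => h A.1 A.2) x

instance : Add (S.Content r hr) where
  add := Quotient.map₂ (fun A B : S.Eidostate =>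
      (⟨S.comb A.1 B.1, comb_mem_eido A.2 B.2⟩ : S.Eidostate))
    fun A A' h B B' h' => ⟨comb_arrow_comb A'.2 B.2 B'.2 h.1 h'.1,
      comb_arrow_comb A.2 B'.2 B.2 h.2 h'.2⟩

instance : Zero (S.Content r hr) := ⟨mk hr {r} (S.singleton_mem r)⟩

theorem mk_comb (hA : A ∈ S.Eido) (hB : B ∈ S.Eido) (h : S.comb A B ∈ S.Eido) :
    mk hr (S.comb A B) h = mk hr A hA + mk hr B hB := rfl

theorem le_of_add_state_le {x y : S.Content r hr} (h : x + mk hr {s} (S.singleton_mem s) ≤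
    y + mk hr {s} (S.singleton_mem s)) : x ≤ y := by
  induction x using ind
  induction y using ind
  exact S.arrow_cancel _ _ s h

instance : AddCommSemigroup (S.Content r hr) where
  add_assoc x y z := by
    induction x using ind with | h A hA
    induction y using ind with | h B hB
    induction z using ind with | h C hC
    have h₁ := comb_mem_eido (comb_mem_eido hA hB) hC
    have h₂ := comb_mem_eido hA (comb_mem_eido hB hC)
    exact mk_eq_mk.mpr ⟨S.arrow_of_sim _ _ h₁ h₂ (S.sim_assoc A B C),
      S.arrow_of_sim _ _ h₂ h₁ (S.sim_symm _ _ (S.sim_assoc A B C))⟩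
  add_comm x y := by
    induction x using ind with | h A hA
    induction y using ind with | h B hB
    exact mk_eq_mk.mpr ⟨comb_comm_arrow hA hB, comb_comm_arrow hB hA⟩

/-- A record state is neutral. -/
theorem add_mk_record (hs : S.IsRecord s) (x : S.Content r hr) :
    x + mk hr {s} (S.singleton_mem s) = x := by
  obtain ⟨a, ha⟩ := hs
  have h : mk hr {a} (S.singleton_mem a) =
      mk hr {a} (S.singleton_mem a) + mk hr {s} (S.singleton_mem s) := mk_eq_mk.mpr ha
  have h' : x + mk hr {s} (S.singleton_mem s) + mk hr {a} (S.singleton_mem a) =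
      x + mk hr {a} (S.singleton_mem a) := by
    conv_rhs => rw [h]
    rw [add_assoc, add_comm (mk hr {s} _)]
  exact le_antisymm (le_of_add_state_le h'.le) (le_of_add_state_le h'.ge)

instance : AddCommMonoid (S.Content r hr) where
  zero_add x := by rw [add_comm]; exact add_mk_record hr x
  add_zero x := add_mk_record hr x
  add_comm := add_comm
  nsmul := nsmulRec

instance : IsOrderedAddMonoid (S.Content r hr) where
  add_le_add_left x y h z := by
    induction x using ind with | h A hA
    induction y using ind with | h B hB
    induction z using ind with | h C hC
    exact S.arrow_comb _ _ _ h

theorem mk_singleton_eq_zero (hs : S.IsRecord s) : mk hr {s} (S.singleton_mem s) = 0 := by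
  rw [← zero_add (mk hr {s} _), add_mk_record hs]

theorem isRecord_of_mk_eq_zero (h : mk hr {s} (S.singleton_mem s) = 0) : S.IsRecord s := by
  refine ⟨r, mk_eq_mk (hr := hr) (hA := S.singleton_mem r)
    (hB := comb_mem_eido (S.singleton_mem r) (S.singleton_mem s)) |>.mp ?_⟩
  rw [mk_comb (S.singleton_mem r) (S.singleton_mem s), h, add_zero]

/-- The classes of singleton eidostates. -/
def states (S : EidoSys) (r : S.State) (hr : S.IsRecord r) : AddSubmonoid (S.Content r hr) where
  carrier := { x | ∃ a, x = mk hr {a} (S.singleton_mem a) }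
  zero_mem' := ⟨r, rfl⟩
  add_mem' := by
    rintro _ _ ⟨a, rfl⟩ ⟨b, rfl⟩
    refine ⟨S.pair a b, ?_⟩
    rw [← mk_comb _ _ (comb_mem_eido (S.singleton_mem a) (S.singleton_mem b))]
    simp only [comb_singleton]

theorem mk_mem_states (a : S.State) : mk hr {a} (S.singleton_mem a) ∈ states S r hr := ⟨a, rfl⟩

end Content

theorem copies_mem_eido (hA : A ∈ S.Eido) : ∀ n, S.copies A n ∈ S.Eido
  | 0 => hA
  | n + 1 => comb_mem_eido hA (copies_mem_eido hA n)

theorem addCopies_mem_eido (hA : A ∈ S.Eido) (hB : B ∈ S.Eido) : ∀ n, S.addCopies A B n ∈ S.Eido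
  | 0 => hA
  | n + 1 => comb_mem_eido (addCopies_mem_eido hA hB n) hB

namespace Content

variable {hr : S.IsRecord r}

theorem mk_copies (hA : A ∈ S.Eido) (n : ℕ) :
    mk hr (S.copies A n) (copies_mem_eido hA n) = (n + 1) • mk hr A hA := by
  induction n with
  | zero => simp [copies]
  | succ n ih => rw [succ_nsmul', ← ih]; rfl

theorem mk_addCopies (hA : A ∈ S.Eido) (hB : B ∈ S.Eido) (n : ℕ) :
    mk hr (S.addCopies A B n) (addCopies_mem_eido hA hB n) = mk hr A hA + n • mk hr B hB := by
  induction n with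
  | zero => simp [addCopies]
  | succ n ih => rw [succ_nsmul, ← add_assoc, ← ih]; rfl

end Content

theorem IsRecord.arrow (hr : S.IsRecord r) (hs : S.IsRecord s) : S.Arrow {r} {s} :=
  (Content.mk_eq_mk.mp (Content.mk_singleton_eq_zero (hr := hr) hs)).2

theorem IsRecord.pair (hr : S.IsRecord r) (hs : S.IsRecord s) : S.IsRecord (S.pair r s) := by
  apply Content.isRecord_of_mk_eq_zero (hr := hr)
  have h := Content.mk_comb (hr := hr) (S.singleton_mem r) (S.singleton_mem s)
    (comb_mem_eido (S.singleton_mem r) (S.singleton_mem s))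
  simp only [comb_singleton] at h
  rw [h, Content.mk_singleton_eq_zero hs, add_zero]
  rfl

theorem IsRecord.isInfo (hr : S.IsRecord r) : S.IsInfo {r} :=
  ⟨S.singleton_mem r, by simpa using hr⟩

theorem IsInfo.comb (hI : S.IsInfo I) (hJ : S.IsInfo J) : S.IsInfo (S.comb I J) := by
  refine ⟨comb_mem_eido hI.1 hJ.1, fun x hx => ?_⟩
  obtain ⟨u, hu, v, hv, rfl⟩ := Finset.mem_image₂.mp hx
  exact (hI.2 u hu).pair (hJ.2 v hv)

theorem IsInfo.subset (hI : S.IsInfo I) (h : J ⊆ I) (hJ : J.Nonempty) : S.IsInfo J :=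
  ⟨S.subset_mem I J hI.1 h hJ, fun x hx => hI.2 x (h hx)⟩

theorem card_comb (A B : Finset S.State) : (S.comb A B).card = A.card * B.card := by
  apply Finset.card_image₂_iff.mpr
  rintro ⟨a, b⟩ - ⟨a', b'⟩ - h
  obtain ⟨rfl, rfl⟩ := S.pair_inj _ _ _ _ h
  rfl

/-- A natural process between information states extends to one more record on each side. -/
theorem IsInfo.arrow_of_arrow_erase (hI : S.IsInfo I) (hJ : S.IsInfo J) {i j : S.State} (hi : i ∈ I)
    (hj : j ∈ J) (hI' : (I.erase i).Nonempty) (hJ' : (J.erase j).Nonempty)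
    (h : S.Arrow (I.erase i) (J.erase j)) : S.Arrow I J := by
  have hu : ∀ K, S.IsInfo K → ∀ a ∈ K, ∀ b ∈ K, S.Arrow {a} {b} ∨ S.Arrow {b} {a} :=
    fun K hK a ha b hb => Or.inl ((hK.2 a ha).arrow (hK.2 b hb))
  have hIu : {i} ∪ I.erase i = I := by simpa [← Finset.insert_eq] using Finset.insert_erase hi
  have hJu : {j} ∪ J.erase j = J := by simpa [← Finset.insert_eq] using Finset.insert_erase hj
  have := S.arrow_union {i} (I.erase i) {j} (J.erase j) (S.singleton_mem i)
    (hI.subset (Finset.erase_subset _ _) hI').1 (S.singleton_mem j)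
    (hJ.subset (Finset.erase_subset _ _) hJ').1 (by simp) (by simp)
    (by rw [hIu]; exact hu I hI) (by rw [hJu]; exact hu J hJ)
    ((hI.2 i hi).arrow (hJ.2 j hj)) h
  rwa [hIu, hJu] at this

/-- A possible bit process is natural. -/
theorem IsBit.arrow_of_pos (hr : S.IsRecord r) (hI : S.IsBit I) (h : S.Pos {r} I) :
    S.Arrow {r} I := by
  refine h.resolve_right fun h' => ?_
  obtain ⟨u, v, huv, rfl⟩ := Finset.card_eq_two.mp hI.2
  refine S.arrow_nsubset {u, v} {u} hI.1.1 (S.singleton_mem u) ?_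
    (S.arrow_trans _ _ _ h' (hr.arrow (hI.1.2 u (by simp))))
  rw [Finset.ssubset_iff_of_subset (by simp)]
  exact ⟨v, by simp, by simpa using huv.symm⟩

section Bit

variable {Ib : Finset S.State}

theorem IsRecord.arrow_isInfo (hr : S.IsRecord r) (hb : S.IsBit Ib) (hΘ : S.Arrow {r} Ib)
    (hJ : S.IsInfo J) : S.Arrow {r} J := by
  obtain ⟨n, hn⟩ : ∃ n, J.card = n + 1 :=
    Nat.exists_eq_succ_of_ne_zero (Finset.card_pos.mpr (S.eido_nonempty J hJ.1)).ne'
  induction n generalizing J with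
  | zero =>
    obtain ⟨j, rfl⟩ := Finset.card_eq_one.mp hn
    exact hr.arrow (hJ.2 j (by simp))
  | succ n ih =>
    obtain ⟨j, hj⟩ := S.eido_nonempty J hJ.1
    have hJc : (J.erase j).card = n + 1 := by rw [Finset.card_erase_of_mem hj, hn]; rfl
    have hJ' : (J.erase j).Nonempty := Finset.card_pos.mp (by omega)
    have hrJ := ih (hJ.subset (Finset.erase_subset _ _) hJ') hJc
    refine S.arrow_trans _ _ _ hΘ ?_
    obtain ⟨u, v, huv, rfl⟩ := Finset.card_eq_two.mp hb.2
    have hv : ({u, v} : Finset S.State).erase u = {v} := by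
      rw [Finset.erase_insert (by simpa using huv)]
    refine hb.1.arrow_of_arrow_erase hJ (i := u) (by simp) hj (by simp [hv]) hJ' ?_
    rw [hv]
    exact S.arrow_trans _ _ _ ((hb.1.2 v (by simp)).arrow hr) hrJ

theorem IsInfo.arrow_of_card_le (hr : S.IsRecord r) (hb : S.IsBit Ib) (hΘ : S.Arrow {r} Ib)
    (hI : S.IsInfo I) (hJ : S.IsInfo J) (h : I.card ≤ J.card) : S.Arrow I J := by
  obtain ⟨n, hn⟩ : ∃ n, I.card = n + 1 :=
    Nat.exists_eq_succ_of_ne_zero (Finset.card_pos.mpr (S.eido_nonempty I hI.1)).ne'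
  induction n generalizing I J with
  | zero =>
    obtain ⟨i, rfl⟩ := Finset.card_eq_one.mp hn
    exact S.arrow_trans _ _ _ ((hI.2 i (by simp)).arrow hr) (hr.arrow_isInfo hb hΘ hJ)
  | succ n ih =>
    obtain ⟨i, hi⟩ := S.eido_nonempty I hI.1
    obtain ⟨j, hj⟩ := S.eido_nonempty J hJ.1
    have hIc : (I.erase i).card = n + 1 := by rw [Finset.card_erase_of_mem hi, hn]; rfl
    have hJc := Finset.card_erase_of_mem hj
    have hI' : (I.erase i).Nonempty := Finset.card_pos.mp (by omega)
    have hJ' : (J.erase j).Nonempty := Finset.card_pos.mp (by omega)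
    exact hI.arrow_of_arrow_erase hJ hi hj hI' hJ' (ih (hI.subset (Finset.erase_subset _ _) hI')
      (hJ.subset (Finset.erase_subset _ _) hJ') (by omega) hIc)

theorem IsInfo.card_le_of_arrow (hr : S.IsRecord r) (hb : S.IsBit Ib) (hΘ : S.Arrow {r} Ib)
    (hI : S.IsInfo I) (hJ : S.IsInfo J) (h : S.Arrow I J) : I.card ≤ J.card := by
  by_contra! hlt
  obtain ⟨K, hKI, hK⟩ := Finset.exists_subset_card_eq hlt.le
  have hKn : K.Nonempty := Finset.card_pos.mp
    (hK ▸ Finset.card_pos.mpr (S.eido_nonempty J hJ.1))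
  have hKinfo := hI.subset hKI hKn
  refine S.arrow_nsubset I K hI.1 hKinfo.1 (hKI.ssubset_of_ne ?_)
    (S.arrow_trans _ _ _ h (hJ.arrow_of_card_le hr hb hΘ hKinfo hK.ge))
  rintro rfl
  omega

theorem isInfo_addCopies (hI : S.IsInfo I) (hJ : S.IsInfo J) : ∀ n, S.IsInfo (S.addCopies I J n)
  | 0 => hI
  | n + 1 => (isInfo_addCopies hI hJ n).comb hJ

theorem card_addCopies_bit (hb : S.IsBit Ib) (n : ℕ) :
    (S.addCopies {r} Ib n).card = 2 ^ n := by
  induction n with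
  | zero => simp [addCopies]
  | succ n ih => rw [addCopies, card_comb, ih, hb.2, pow_succ]

namespace Content

variable {hr : S.IsRecord r}

theorem mk_addCopies_record (hb : S.IsBit Ib) (n : ℕ) :
    mk hr (S.addCopies {r} Ib n) (addCopies_mem_eido (S.singleton_mem r) hb.1.1 n) =
      n • mk hr Ib hb.1.1 := by
  rw [mk_addCopies (S.singleton_mem r) hb.1.1, mk_singleton_eq_zero hr, zero_add]

theorem isBitMonoid (hdemon : S.DemonAxiom) (hstab : S.StabilityAxiom) (hr : S.IsRecord r)
    (hb : S.IsBit Ib) (hΘ : S.Arrow {r} Ib) : IsBitMonoid (states S r hr) (mk hr Ib hb.1.1) where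
  cancel x y := by
    rintro _ ⟨s, rfl⟩ h
    exact le_of_add_state_le h
  bits i j h := by
    rw [← mk_addCopies_record hb, ← mk_addCopies_record hb, mk_le_mk] at h
    have := (isInfo_addCopies hr.isInfo hb.1 i).card_le_of_arrow hr hb hΘ
      (isInfo_addCopies hr.isInfo hb.1 j) h
    rw [card_addCopies_bit hb, card_addCopies_bit hb] at this
    exact (Nat.pow_le_pow_iff_right (by norm_num)).mp this
  near_symm := by
    rintro _ ⟨a, rfl⟩ _ ⟨b, rfl⟩ ⟨k, h⟩
    rw [← mk_addCopies_record hb, ← mk_comb (h := comb_mem_eido (S.singleton_mem b)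
      (addCopies_mem_eido (S.singleton_mem r) hb.1.1 k)), mk_le_mk] at h
    obtain ⟨I, hI, hle⟩ := (hdemon a b _ (isInfo_addCopies hr.isInfo hb.1 k) h).1
    have hI' : S.Arrow I (S.addCopies {r} Ib I.card) := by
      refine hI.arrow_of_card_le hr hb hΘ (isInfo_addCopies hr.isInfo hb.1 _) ?_
      rw [card_addCopies_bit hb]
      exact Nat.lt_two_pow_self.le
    rw [← mk_le_mk (hr := hr) (hA := hI.1) (hB := addCopies_mem_eido (S.singleton_mem r) hb.1.1 _),
      mk_addCopies_record hb] at hI'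
    rw [← mk_le_mk (hr := hr) (hA := S.singleton_mem b)
      (hB := comb_mem_eido (S.singleton_mem a) hI.1), mk_comb (S.singleton_mem a) hI.1] at hle
    exact ⟨I.card, hle.trans (add_le_add_right hI' _)⟩
  total := by
    rintro _ ⟨a, rfl⟩ _ ⟨b, rfl⟩ ⟨k, h⟩ n
    rw [← mk_addCopies_record hb, ← mk_comb (h := comb_mem_eido (S.singleton_mem b)
      (addCopies_mem_eido (S.singleton_mem r) hb.1.1 k)), mk_le_mk] at h
    have := (hdemon a b _ (isInfo_addCopies hr.isInfo hb.1 k) h).2 _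
      (isInfo_addCopies hr.isInfo hb.1 n)
    rw [← mk_addCopies_record hb]
    exact this
  stable := by
    rintro _ ⟨a, rfl⟩ _ ⟨b, rfl⟩ h
    refine hstab {a} {b} Ib (S.singleton_mem a) (S.singleton_mem b) hb.1 fun N => ⟨N, le_rfl, ?_⟩
    have := h N
    rwa [← mk_copies, ← mk_copies, ← mk_comb (h := comb_mem_eido
      (copies_mem_eido (S.singleton_mem b) N) hb.1.1), mk_le_mk] at this

theorem near_of_pos (hdemon : S.DemonAxiom) (hstab : S.StabilityAxiom) (hb : S.IsBit Ib)
    (hΘ : S.Arrow {r} Ib) (h : S.Pos {a} {b}) :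
    Near (mk hr Ib hb.1.1) (mk hr {a} (S.singleton_mem a)) (mk hr {b} (S.singleton_mem b)) := by
  rcases h with h | h
  · exact .of_le h
  · exact (isBitMonoid hdemon hstab hr hb hΘ).near_symm _ (mk_mem_states b) _ (mk_mem_states a)
      (.of_le h)

end Content

theorem qpProc_mem_eido (hA : A ∈ S.Eido) (hB : B ∈ S.Eido) (hb : S.IsBit Ib) (q : ℕ) (p : ℤ) :
    (S.qpProc A B r Ib q p).1 ∈ S.Eido ∧ (S.qpProc A B r Ib q p).2 ∈ S.Eido := by
  have hA' := copies_mem_eido hA (q - 1)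
  have hB' := copies_mem_eido hB (q - 1)
  unfold qpProc
  split_ifs
  · exact ⟨addCopies_mem_eido hA' hb.1.1 _, addCopies_mem_eido hB' (S.singleton_mem r) _⟩
  · exact ⟨addCopies_mem_eido hA' (S.singleton_mem r) _, addCopies_mem_eido hB' hb.1.1 _⟩

variable {hr : S.IsRecord r}

open Content in
theorem mk_qpProc (hA : A ∈ S.Eido) (hB : B ∈ S.Eido) (hb : S.IsBit Ib) {q : ℕ} (hq : 0 < q)
    (p : ℤ) :
    Content.mk hr (S.qpProc A B r Ib q p).1 (qpProc_mem_eido hA hB hb q p).1 =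
        q • Content.mk hr A hA + p.toNat • Content.mk hr Ib hb.1.1 ∧
      Content.mk hr (S.qpProc A B r Ib q p).2 (qpProc_mem_eido hA hB hb q p).2 =
        q • Content.mk hr B hB + (-p).toNat • Content.mk hr Ib hb.1.1 := by
  obtain ⟨n, rfl⟩ := Nat.exists_eq_succ_of_ne_zero hq.ne'
  have hn : n.succ - 1 = n := rfl
  by_cases hp : 0 ≤ p
  · have h0 : (-p).toNat = 0 := by omega
    simp only [qpProc, hp, if_true, hn, h0, zero_nsmul, add_zero]
    rw [mk_addCopies (copies_mem_eido hA n) hb.1.1,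
      mk_addCopies (copies_mem_eido hB n) (S.singleton_mem r), mk_copies hA, mk_copies hB,
      mk_singleton_eq_zero hr, nsmul_zero, add_zero]
    exact ⟨rfl, rfl⟩
  · have h0 : p.toNat = 0 := by omega
    simp only [qpProc, hp, if_false, hn, h0, zero_nsmul, add_zero]
    rw [mk_addCopies (copies_mem_eido hA n) (S.singleton_mem r),
      mk_addCopies (copies_mem_eido hB n) hb.1.1, mk_copies hA, mk_copies hB,
      mk_singleton_eq_zero hr, nsmul_zero, add_zero]
    exact ⟨rfl, rfl⟩

open Content in
theorem LSet_eq_lowerCut (hr : S.IsRecord r) (hA : A ∈ S.Eido) (hB : B ∈ S.Eido)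
    (hb : S.IsBit Ib) :
    S.LSet A B r Ib = lowerCut (Content.mk hr Ib hb.1.1) (Content.mk hr A hA) (Content.mk hr B hB) := by
  ext x
  refine exists_congr fun p => exists_congr fun q => and_congr_right fun hq =>
    and_congr_right fun _ => ?_
  obtain ⟨h₁, h₂⟩ := mk_qpProc (hr := hr) hA hB hb hq p
  rw [← h₁, ← h₂, mk_le_mk]

open Content in
theorem USet_eq_upperCut (hr : S.IsRecord r) (hA : A ∈ S.Eido) (hB : B ∈ S.Eido)
    (hb : S.IsBit Ib) :
    S.USet A B r Ib = upperCut (Content.mk hr Ib hb.1.1) (Content.mk hr A hA) (Content.mk hr B hB) := by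
  ext x
  refine exists_congr fun p => exists_congr fun q => and_congr_right fun hq =>
    and_congr_right fun _ => ?_
  obtain ⟨h₁, h₂⟩ := mk_qpProc (hr := hr) hA hB hb hq p
  rw [← h₁, ← h₂, mk_le_mk]

open Content in
theorem IrrFn_eq_cutValue (hr : S.IsRecord r) (hA : A ∈ S.Eido) (hB : B ∈ S.Eido)
    (hb : S.IsBit Ib) :
    S.IrrFn r Ib (A, B) = cutValue (Content.mk hr Ib hb.1.1) (Content.mk hr A hA) (Content.mk hr B hB) := by
  rw [IrrFn, LSet_eq_lowerCut hr hA hB hb, cutValue]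

end Bit

end EidoSys

/-- For each possible singleton process α = ({a},{b}), the sets
L_α = { p/q : q > 0, qα − pΘ_b natural } and U_α = { p/q : q > 0, pΘ_b − qα natural } form a
Dedekind cut of ℚ, sup L_α = inf U_α, and α ↦ 𝕀(α) := sup L_α is an irreversibility function
on the set P̂_S of (classes of) possible singleton processes. -/
theorem stmt9 (S : EidoSys) (hinfo : S.InfoAxiom) (hdemon : S.DemonAxiom)
    (hstab : S.StabilityAxiom)
    (r : S.State) (Ib : Finset S.State) (hr : S.IsRecord r) (hb : S.IsBit Ib)
    (hΘ : S.Pos {r} Ib) :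
    (∀ a b : S.State, S.Pos {a} {b} →
      (S.LSet {a} {b} r Ib).Nonempty ∧
      (S.USet {a} {b} r Ib).Nonempty ∧
      (∀ x : ℚ, x ∈ S.LSet {a} {b} r Ib ∪ S.USet {a} {b} r Ib) ∧
      (∀ x ∈ S.LSet {a} {b} r Ib, ∀ y ∈ S.USet {a} {b} r Ib, x ≤ y) ∧
      sSup ((fun x : ℚ => (x : ℝ)) '' S.LSet {a} {b} r Ib) =
        sInf ((fun x : ℚ => (x : ℝ)) '' S.USet {a} {b} r Ib)) ∧
    S.IsIrrevFn { p : S.Proc | ∃ a b : S.State, p = ({a}, {b}) ∧ S.Pos {a} {b} }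
      (S.IrrFn r Ib) := by
  have hΘ' := hb.arrow_of_pos hr hΘ
  have H := EidoSys.Content.isBitMonoid hdemon hstab hr hb hΘ'
  have hmem := EidoSys.Content.mk_mem_states (hr := hr)
  have hnear : ∀ {a b : S.State}, S.Pos {a} {b} → Near (EidoSys.Content.mk hr Ib hb.1.1)
      (EidoSys.Content.mk hr {a} (S.singleton_mem a))
      (EidoSys.Content.mk hr {b} (S.singleton_mem b)) :=
    fun h => EidoSys.Content.near_of_pos hdemon hstab hb hΘ' h
  refine ⟨fun a b h => ?_, ?_, ?_, ?_, ?_, ?_⟩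
  · rw [EidoSys.LSet_eq_lowerCut hr (S.singleton_mem a) (S.singleton_mem b) hb,
      EidoSys.USet_eq_upperCut hr (S.singleton_mem a) (S.singleton_mem b) hb]
    exact ⟨lowerCut_nonempty (hnear h), upperCut_nonempty (hnear h.symm),
      H.mem_lowerCut_union_upperCut (hmem a) (hmem b) (hnear h),
      H.lowerCut_le_upperCut (hmem a) (hmem b),
      H.cutValue_eq_sInf (hmem a) (hmem b) (hnear h)⟩
  · rintro _ ⟨a, b, rfl, h⟩ _ ⟨c, d, rfl, h'⟩ ⟨x, y, hac, hbd⟩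
    rw [EidoSys.IrrFn_eq_cutValue hr (S.singleton_mem a) (S.singleton_mem b) hb,
      EidoSys.IrrFn_eq_cutValue hr (S.singleton_mem c) (S.singleton_mem d) hb]
    have hsim : ∀ {u v w z : S.State}, S.Sim (S.comb {u} {v}) (S.comb {w} {z}) →
        EidoSys.Content.mk hr {u} (S.singleton_mem u) +
          EidoSys.Content.mk hr {v} (S.singleton_mem v) =
        EidoSys.Content.mk hr {w} (S.singleton_mem w) +
          EidoSys.Content.mk hr {z} (S.singleton_mem z) := by
      intro u v w z huv
      have h₁ := EidoSys.comb_mem_eido (S.singleton_mem u) (S.singleton_mem v)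
      have h₂ := EidoSys.comb_mem_eido (S.singleton_mem w) (S.singleton_mem z)
      exact EidoSys.Content.mk_eq_mk.mpr
        ⟨S.arrow_of_sim _ _ h₁ h₂ huv, S.arrow_of_sim _ _ h₂ h₁ (S.sim_symm _ _ huv)⟩
    exact H.cutValue_congr (hmem a) (hmem b) (hnear h) (hmem c) (hmem d) (hnear h') (hmem x)
      (hmem y) (hsim hac) (hsim hbd)
  · rintro _ ⟨a, b, rfl, h⟩ _ ⟨c, d, rfl, h'⟩
    rw [EidoSys.psum,
      EidoSys.IrrFn_eq_cutValue hr (EidoSys.comb_mem_eido (S.singleton_mem a) (S.singleton_mem c))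
        (EidoSys.comb_mem_eido (S.singleton_mem b) (S.singleton_mem d)) hb,
      EidoSys.IrrFn_eq_cutValue hr (S.singleton_mem a) (S.singleton_mem b) hb,
      EidoSys.IrrFn_eq_cutValue hr (S.singleton_mem c) (S.singleton_mem d) hb]
    rw [EidoSys.Content.mk_comb (S.singleton_mem a) (S.singleton_mem c),
      EidoSys.Content.mk_comb (S.singleton_mem b) (S.singleton_mem d)]
    exact H.cutValue_add (hmem a) (hmem b) (hnear h) (hmem c) (hmem d) (hnear h')
  · rintro _ ⟨a, b, rfl, -⟩ hle hnle
    rw [EidoSys.IrrFn_eq_cutValue hr (S.singleton_mem a) (S.singleton_mem b) hb]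
    exact H.cutValue_pos (hmem a) (hmem b) hle hnle
  · rintro _ ⟨a, b, rfl, -⟩ hle hle'
    rw [EidoSys.IrrFn_eq_cutValue hr (S.singleton_mem a) (S.singleton_mem b) hb]
    exact H.cutValue_eq_zero (hmem a) (hmem b) hle hle'
  · rintro _ ⟨a, b, rfl, h⟩ hle hnle
    rw [EidoSys.IrrFn_eq_cutValue hr (S.singleton_mem a) (S.singleton_mem b) hb,
      H.cutValue_swap (hmem b) (hmem a) (hnear h.symm), neg_lt_zero]
    exact H.cutValue_pos (hmem b) (hmem a) hle hnle
end
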